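/- arXiv:2308.03066 — 2 statements merged into one kernel-verified Lean document; each statement's English description precedes it below -/
import Mathlib

section
/- Let G be a finite abelian group of exponent m and let Γ = SC(G, T₁₁, T₂₂, T₁₂, T₂₁) be a semi-Cayley digraph with adjacency matrix A, and I₁, I₂, I₃ as below. Let K be the subfield of ℂ generated over ℚ by all values χ(I₁) and χ(I₂ \ I₃) − χ(I₃ \ I₂), χ ranging over the group homomorphisms from G to ℂˣ; let T = {t ∈ (ℤ/mℤ)ˣ : I₁^t = I₁, (I₂ \ I₃)^t = I₂ \ I₃, (I₃ \ I₂)^t = I₃ \ I₂}; and let M be the subgroup of Kˣ/(Kˣ)² generated by the classes of the nonzero values χ(I₂ \ I₃) − χ(I₃ \ I₂). Then the splitting field SF(Γ) equals the subfield of ℂ generated over K by all z ∈ ℂ with z² = χ(I₂ \ I₃) − χ(I₃ \ I₂) for some group homomorphism χ : G → ℂˣ, and deg(Γ)·|T| = φ(m)·|M|, where φ is Euler's totient function. -/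
open IntermediateField

/-- The adjacency matrix (over ℚ, with 0/1 entries) of the semi-Cayley digraph
`SC(G, T₁₁, T₂₂, T₁₂, T₂₁)`. -/
def scMatrix {G : Type*} [Group G] [DecidableEq G] (T11 T22 T12 T21 : Finset G) :
    Matrix (G ⊕ G) (G ⊕ G) ℚ :=
  fun x y =>
    match x, y with
    | Sum.inl h, Sum.inl g => if g * h⁻¹ ∈ T11 then 1 else 0
    | Sum.inr h, Sum.inr g => if g * h⁻¹ ∈ T22 then 1 else 0
    | Sum.inl h, Sum.inr g => if g * h⁻¹ ∈ T12 then 1 else 0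
    | Sum.inr h, Sum.inl g => if g * h⁻¹ ∈ T21 then 1 else 0

/-- The multiset of pairwise products `[x·y : x ∈ X, y ∈ Y]` of two multisets of a group. -/
def msProd {G : Type*} [Group G] (X Y : Multiset G) : Multiset G :=
  X.bind (fun x => Y.map (fun y => x * y))

/-- The `t`-th power map on multisets of a group, for `t` a unit modulo the exponent. -/
def msPow {G : Type*} [Group G] {m : ℕ} (t : (ZMod m)ˣ) (X : Multiset G) : Multiset G :=
  X.map (fun x => x ^ ((t : ZMod m).val))

/-- The sum of the values of a character `χ : G →* ℂˣ` over a multiset, with multiplicity. -/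
noncomputable def charSumHom {G : Type*} [Group G] (χ : G →* ℂˣ) (X : Multiset G) : ℂ :=
  (X.map (fun x => ((χ x : ℂˣ) : ℂ))).sum

section CharacterSums

variable {G : Type*} [CommGroup G]

theorem charSumHom_add (χ : G →* ℂˣ) (X Y : Multiset G) :
    charSumHom χ (X + Y) = charSumHom χ X + charSumHom χ Y := by
  simp [charSumHom]

theorem charSumHom_nsmul (χ : G →* ℂˣ) (n : ℕ) (X : Multiset G) :
    charSumHom χ (n • X) = n * charSumHom χ X := by
  simp [charSumHom, Multiset.map_nsmul, Multiset.sum_nsmul]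

theorem charSumHom_msProd (χ : G →* ℂˣ) (X Y : Multiset G) :
    charSumHom χ (msProd X Y) = charSumHom χ X * charSumHom χ Y := by
  simp [charSumHom, msProd, Multiset.map_bind, Multiset.sum_bind, Multiset.sum_map_mul_left,
    Multiset.sum_map_mul_right]

theorem charSumHom_val (χ : G →* ℂˣ) (S : Finset G) :
    charSumHom χ S.val = ∑ g ∈ S, (χ g : ℂ) := rfl

theorem charSumHom_sub_sub [DecidableEq G] (χ : G →* ℂˣ) (X Y : Multiset G) :
    charSumHom χ (X - Y) - charSumHom χ (Y - X) = charSumHom χ X - charSumHom χ Y := by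
  have h : X - Y + Y = Y - X + X := by
    ext g
    simp only [Multiset.count_add, Multiset.count_sub]
    omega
  have := congrArg (charSumHom χ) h
  rw [charSumHom_add, charSumHom_add] at this
  linear_combination this

theorem charSumHom_eq_sum_count [Fintype G] [DecidableEq G] (χ : G →* ℂˣ) (X : Multiset G) :
    charSumHom χ X = ∑ g, (X.count g : ℂ) * χ g := by
  rw [charSumHom, Finset.sum_multiset_map_count]
  simp only [nsmul_eq_mul]
  refine Finset.sum_subset (Finset.subset_univ _) fun g _ hg => ?_
  simp [Multiset.count_eq_zero.2 (by simpa using hg)]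

theorem eq_zero_of_forall_character_sum_eq_zero [Fintype G] (f : G → ℂ)
    (h : ∀ χ : G →* ℂˣ, ∑ g, f g * (χ g : ℂ) = 0) : f = 0 := by
  let ev : G → ((G →* ℂˣ) →* ℂ) := fun g => (Units.coeHom ℂ).comp (MonoidHom.eval g)
  have : NeZero (Monoid.exponent G) := ⟨Monoid.exponent_ne_zero_of_finite⟩
  have hev : Function.Injective ev := fun g g' hg =>
    (CommGroup.forall_apply_eq_apply_iff (M := ℂ) G).1 fun χ =>
      Units.ext (DFunLike.congr_fun hg χ)
  have hli := (linearIndependent_monoidHom (G →* ℂˣ) ℂ).comp ev hev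
  rw [Fintype.linearIndependent_iff] at hli
  funext g
  refine hli f ?_ g
  funext χ
  simpa [ev] using h χ

theorem multiset_eq_of_charSumHom_eq [Fintype G] [DecidableEq G] {X Y : Multiset G}
    (h : ∀ χ, charSumHom χ X = charSumHom χ Y) : X = Y := by
  have := eq_zero_of_forall_character_sum_eq_zero
    (fun g => (X.count g : ℂ) - Y.count g) fun χ => by
      simp only [sub_mul, Finset.sum_sub_distrib, ← charSumHom_eq_sum_count, h χ, sub_self]
  ext g
  exact_mod_cast sub_eq_zero.1 (congrFun this g)

theorem sum_sum_mul_inv_character [Fintype G] (χ : G →* ℂˣ) (S : Finset G) (F : G → ℂ) :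
    ∑ h, (∑ t ∈ S, F (t * h)) * ((χ⁻¹ h : ℂˣ) : ℂ) =
      charSumHom χ S.val * ∑ g, F g * ((χ⁻¹ g : ℂˣ) : ℂ) := by
  simp only [Finset.sum_mul]
  rw [Finset.sum_comm, charSumHom_val, Finset.sum_mul]
  refine Finset.sum_congr rfl fun t _ => ?_
  rw [← Equiv.sum_comp (Equiv.mulLeft t) (fun g => F g * ((χ⁻¹ g : ℂˣ) : ℂ)), Finset.mul_sum]
  refine Finset.sum_congr rfl fun h _ => ?_
  have : ((χ t : ℂˣ) : ℂ) ≠ 0 := (χ t).ne_zero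
  simp only [Equiv.coe_mulLeft, MonoidHom.inv_apply, map_mul, Units.val_mul,
    Units.val_inv_eq_inv_val]
  field_simp

end CharacterSums

section Spectrum

variable {G : Type*} [CommGroup G] [Fintype G] [DecidableEq G]

theorem sum_ite_mul_inv_mem (S : Finset G) (h : G) (F : G → ℂ) :
    ∑ g, (if g * h⁻¹ ∈ S then (1 : ℂ) else 0) * F g = ∑ t ∈ S, F (t * h) := by
  rw [← Equiv.sum_comp (Equiv.mulRight h)]
  simp [Finset.sum_ite_mem]

theorem scMatrix_map_mulVec_inl (T11 T22 T12 T21 : Finset G) (v : G ⊕ G → ℂ) (h : G) :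
    ((scMatrix T11 T22 T12 T21).map (algebraMap ℚ ℂ)).mulVec v (Sum.inl h) =
      ∑ t ∈ T11, v (Sum.inl (t * h)) + ∑ t ∈ T12, v (Sum.inr (t * h)) := by
  rw [← sum_ite_mul_inv_mem T11 h fun g => v (Sum.inl g),
    ← sum_ite_mul_inv_mem T12 h fun g => v (Sum.inr g)]
  simp [Matrix.mulVec, dotProduct, scMatrix, apply_ite]

theorem scMatrix_map_mulVec_inr (T11 T22 T12 T21 : Finset G) (v : G ⊕ G → ℂ) (h : G) :
    ((scMatrix T11 T22 T12 T21).map (algebraMap ℚ ℂ)).mulVec v (Sum.inr h) =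
      ∑ t ∈ T21, v (Sum.inl (t * h)) + ∑ t ∈ T22, v (Sum.inr (t * h)) := by
  rw [← sum_ite_mul_inv_mem T21 h fun g => v (Sum.inl g),
    ← sum_ite_mul_inv_mem T22 h fun g => v (Sum.inr g)]
  simp [Matrix.mulVec, dotProduct, scMatrix, apply_ite]

theorem Matrix.aeval_charpoly_eq_zero_iff_exists_mulVec {n : Type*} [Fintype n] [DecidableEq n]
    (A : Matrix n n ℚ) (z : ℂ) :
    Polynomial.aeval z A.charpoly = 0 ↔
      ∃ v : n → ℂ, v ≠ 0 ∧ (A.map (algebraMap ℚ ℂ)).mulVec v = z • v := by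
  rw [Polynomial.aeval_def, ← Polynomial.eval_map, ← Matrix.charpoly_map, Matrix.eval_charpoly,
    ← Matrix.exists_mulVec_eq_zero_iff]
  refine exists_congr fun v => and_congr_right fun _ => ?_
  rw [Matrix.sub_mulVec, sub_eq_zero, eq_comm]
  simp [Matrix.scalar_apply, funext_iff]

theorem exists_ne_zero_mul_add_mul_eq_smul_iff (a b c d z : ℂ) :
    (∃ x y : ℂ, (x, y) ≠ 0 ∧ a * x + b * y = z * x ∧ c * x + d * y = z * y) ↔
      (z - a) * (z - d) = b * c := by
  constructor
  · rintro ⟨x, y, hxy, h1, h2⟩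
    have hx : x * ((z - a) * (z - d) - b * c) = 0 := by linear_combination (-(z - d)) * h1 - b * h2
    have hy : y * ((z - a) * (z - d) - b * c) = 0 := by linear_combination (-c) * h1 - (z - a) * h2
    by_contra hne
    have hne' := sub_ne_zero.2 hne
    exact hxy (by simp [(mul_eq_zero.1 hx).resolve_right hne', (mul_eq_zero.1 hy).resolve_right hne'])
  · intro h
    by_cases hb : b = 0 ∧ z - a = 0
    · by_cases hd : c = 0 ∧ z - d = 0
      · refine ⟨1, 0, by simp, ?_, ?_⟩
        · linear_combination -hb.2
        · linear_combination hd.1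
      · refine ⟨z - d, c, fun h0 => hd ?_, ?_, ?_⟩
        · simpa [and_comm] using h0
        · linear_combination -(z - d) * hb.2 + c * hb.1
        · ring
    · refine ⟨b, z - a, fun h0 => hb (by simpa using h0), by ring, ?_⟩
      linear_combination -h

/-- The eigenvalues of a semi-Cayley digraph are those of the `2 × 2` matrices of character sums. -/
theorem aeval_charpoly_scMatrix_eq_zero_iff (T11 T22 T12 T21 : Finset G) (z : ℂ) :
    Polynomial.aeval z (scMatrix T11 T22 T12 T21).charpoly = 0 ↔
      ∃ χ : G →* ℂˣ, (z - charSumHom χ T11.val) * (z - charSumHom χ T22.val) =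
        charSumHom χ T12.val * charSumHom χ T21.val := by
  simp only [Matrix.aeval_charpoly_eq_zero_iff_exists_mulVec,
    ← exists_ne_zero_mul_add_mul_eq_smul_iff]
  constructor
  · rintro ⟨v, hv, h⟩
    have hχ : ∃ χ : G →* ℂˣ, (∑ g, v (Sum.inl g) * ((χ⁻¹ g : ℂˣ) : ℂ),
        ∑ g, v (Sum.inr g) * ((χ⁻¹ g : ℂˣ) : ℂ)) ≠ 0 := by
      by_contra! hall
      apply hv
      have h1 := eq_zero_of_forall_character_sum_eq_zero (fun g => v (Sum.inl g)) fun χ => by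
        simpa using congrArg Prod.fst (hall χ⁻¹)
      have h2 := eq_zero_of_forall_character_sum_eq_zero (fun g => v (Sum.inr g)) fun χ => by
        simpa using congrArg Prod.snd (hall χ⁻¹)
      funext x
      rcases x with g | g
      · exact congrFun h1 g
      · exact congrFun h2 g
    obtain ⟨χ, hχ⟩ := hχ
    refine ⟨χ, _, _, hχ, ?_, ?_⟩
    · rw [← sum_sum_mul_inv_character χ T11 fun g => v (Sum.inl g),
        ← sum_sum_mul_inv_character χ T12 fun g => v (Sum.inr g), ← Finset.sum_add_distrib,
        Finset.mul_sum]
      refine Finset.sum_congr rfl fun g _ => ?_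
      have := congrFun h (Sum.inl g)
      rw [scMatrix_map_mulVec_inl, Pi.smul_apply, smul_eq_mul] at this
      rw [← add_mul, this, mul_assoc]
    · rw [← sum_sum_mul_inv_character χ T21 fun g => v (Sum.inl g),
        ← sum_sum_mul_inv_character χ T22 fun g => v (Sum.inr g), ← Finset.sum_add_distrib,
        Finset.mul_sum]
      refine Finset.sum_congr rfl fun g _ => ?_
      have := congrFun h (Sum.inr g)
      rw [scMatrix_map_mulVec_inr, Pi.smul_apply, smul_eq_mul] at this
      rw [← add_mul, this, mul_assoc]
  · rintro ⟨χ, x, y, hxy, h1, h2⟩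
    refine ⟨Sum.elim (fun g => x * (χ g : ℂ)) (fun g => y * (χ g : ℂ)), fun h0 => hxy ?_, ?_⟩
    · have hx := congrFun h0 (Sum.inl 1)
      have hy := congrFun h0 (Sum.inr 1)
      simp at hx hy
      simp [hx, hy]
    · funext w
      rcases w with g | g
      · rw [scMatrix_map_mulVec_inl]
        simp only [Sum.elim_inl, Sum.elim_inr, Pi.smul_apply, smul_eq_mul, map_mul, Units.val_mul,
          ← mul_assoc, ← Finset.sum_mul, ← Finset.mul_sum, ← charSumHom_val]
        linear_combination (χ g : ℂ) * h1
      · rw [scMatrix_map_mulVec_inr]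
        simp only [Sum.elim_inl, Sum.elim_inr, Pi.smul_apply, smul_eq_mul, map_mul, Units.val_mul,
          ← mul_assoc, ← Finset.sum_mul, ← Finset.mul_sum, ← charSumHom_val]
        linear_combination (χ g : ℂ) * h2

end Spectrum

section MultiquadraticExtensions

open Module

variable {K L : Type*} [Field K] [Field L] [Algebra K L]

/-- Square roots of elements of `K` with pairwise ratios outside `K` are linearly independent. -/
theorem linearIndependent_of_sq_mem_range [FiniteDimensional K L] [IsGalois K L] {ι : Type*}
    (r : ι → L) (hr0 : ∀ i, r i ≠ 0) (hr2 : ∀ i, r i ^ 2 ∈ Set.range (algebraMap K L))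
    (hr : ∀ i j, r i / r j ∈ Set.range (algebraMap K L) → i = j) : LinearIndependent K r := by
  have hsign : ∀ (σ : Gal(L/K)) i, σ (r i) / r i = 1 ∨ σ (r i) / r i = -1 := fun σ i => by
    obtain ⟨k, hk⟩ := hr2 i
    rw [← sq_eq_one_iff, div_pow, ← map_pow, ← hk, σ.commutes, hk, div_self (pow_ne_zero 2 (hr0 i))]
  have hfix : ∀ (τ σ : Gal(L/K)) i, τ (σ (r i) / r i) = σ (r i) / r i := fun τ σ i => by
    rcases hsign σ i with h | h <;> simp [h]
  let c : ι → (Gal(L/K) →* L) := fun i =>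
    { toFun := fun σ => σ (r i) / r i
      map_one' := by simp [hr0 i]
      map_mul' := fun τ σ => by
        have h := hfix τ σ i
        rw [map_div₀] at h
        have h' : τ (r i) ≠ 0 := by simpa using hr0 i
        rw [AlgEquiv.mul_apply, ← h]
        have := hr0 i
        field_simp }
  have hc : Function.Injective c := fun i j hij => hr i j <| by
    rw [IsGalois.mem_range_algebraMap_iff_fixed]
    intro σ
    have h : σ (r i) / r i = σ (r j) / r j := DFunLike.congr_fun hij σ
    have h' : σ (r j) ≠ 0 := by simpa using hr0 j
    have hi := hr0 i
    have hj := hr0 j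
    rw [map_div₀]
    field_simp at h ⊢
    linear_combination h
  have hli := (linearIndependent_monoidHom Gal(L/K) L).comp c hc
  rw [linearIndependent_iff'] at hli ⊢
  intro s g hg i hi
  have key := hli s (fun i => algebraMap K L (g i) * r i) ?_ i hi
  · simpa [hr0 i] using key
  · funext σ
    have := congrArg σ hg
    simp only [map_sum, map_zero, Algebra.smul_def, map_mul, AlgEquiv.commutes] at this
    simp only [Finset.sum_apply, Pi.smul_apply, Function.comp_apply, smul_eq_mul, Pi.zero_apply]
    rw [← this]
    refine Finset.sum_congr rfl fun j _ => ?_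
    change algebraMap K L (g j) * r j * (σ (r j) / r j) = _
    have := hr0 j
    field_simp

theorem isIntegral_of_sq_mem_range {s : L} (hs : s ^ 2 ∈ Set.range (algebraMap K L)) :
    IsIntegral K s := by
  obtain ⟨k, hk⟩ := hs
  exact IsIntegral.of_pow two_pos (hk ▸ isIntegral_algebraMap)

theorem isGalois_adjoin_of_sq_mem_range [CharZero K] (S : Set L)
    (hS : ∀ s ∈ S, s ^ 2 ∈ Set.range (algebraMap K L)) : IsGalois K (adjoin K S) := by
  have halg : Algebra.IsAlgebraic K (adjoin K S) :=
    isAlgebraic_adjoin fun s hs => isIntegral_of_sq_mem_range (hS s hs)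
  have : Normal K (adjoin K S) :=
    { splits' := fun x => by
        rw [IntermediateField.minpoly_eq]
        refine splits_of_mem_adjoin K L (fun s hs => ⟨isIntegral_of_sq_mem_range (hS s hs), ?_⟩) x.2
        obtain ⟨k, hk⟩ := hS s hs
        let s' : adjoin K S := ⟨s, subset_adjoin K S hs⟩
        have hk' : algebraMap K (adjoin K S) k = s' ^ 2 := Subtype.ext hk
        have hdvd : minpoly K s ∣ Polynomial.X ^ 2 - Polynomial.C k :=
          minpoly.dvd _ _ (by simp [hk])
        refine Polynomial.Splits.of_dvd ?_ ?_ (Polynomial.map_dvd _ hdvd)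
        · have : (Polynomial.X ^ 2 - Polynomial.C k).map (algebraMap K (adjoin K S)) =
              (Polynomial.X - Polynomial.C s') * (Polynomial.X + Polynomial.C s') := by
            simp only [Polynomial.map_sub, Polynomial.map_pow, Polynomial.map_X, Polynomial.map_C,
              hk', map_pow]
            ring
          rw [this]
          exact (Polynomial.Splits.X_sub_C _).mul (Polynomial.Splits.X_add_C _)
        · exact (Polynomial.map_ne_zero_iff (algebraMap K (adjoin K S)).injective).2
            (Polynomial.X_pow_sub_C_ne_zero two_pos k) }
  exact ⟨⟩

theorem exists_eq_algebraMap_mul_of_mk_eq {u v : Kˣ} {b c : L} (hb : b ^ 2 = algebraMap K L u)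
    (hc : c ^ 2 = algebraMap K L v)
    (h : (QuotientGroup.mk u : Kˣ ⧸ (powMonoidHom 2 : Kˣ →* Kˣ).range) = QuotientGroup.mk v) :
    ∃ k : K, b = algebraMap K L k * c := by
  obtain ⟨w, hw⟩ := QuotientGroup.eq.1 h.symm
  have hu : (u : K) = w ^ 2 * v := by
    have : u = w ^ 2 * v := by
      rw [← powMonoidHom_apply 2 w, hw]
      simp
    exact_mod_cast congrArg Units.val this
  have : b ^ 2 = (algebraMap K L w * c) ^ 2 := by rw [hb, hu, mul_pow, hc, map_mul, map_pow]
  rcases sq_eq_sq_iff_eq_or_eq_neg.1 this with h | h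
  · exact ⟨w, h⟩
  · exact ⟨-w, by rw [h, map_neg, neg_mul]⟩

theorem mk_eq_of_div_mem_range {u v : Kˣ} {b c : L} (hb : b ^ 2 = algebraMap K L u)
    (hc : c ^ 2 = algebraMap K L v) (h : b / c ∈ Set.range (algebraMap K L)) :
    (QuotientGroup.mk u : Kˣ ⧸ (powMonoidHom 2 : Kˣ →* Kˣ).range) = QuotientGroup.mk v := by
  obtain ⟨k, hk⟩ := h
  have hk2 : k ^ 2 = (u / v : Kˣ) := (algebraMap K L).injective <| by
    rw [map_pow, hk, div_pow, hb, hc, Units.val_div_eq_div_val, map_div₀]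
  have hk0 : k ≠ 0 := fun h0 => (u / v).ne_zero (by rw [← hk2, h0]; simp)
  refine QuotientGroup.eq.2 ⟨(Units.mk0 k hk0)⁻¹, Units.ext ?_⟩
  simp only [powMonoidHom_apply, inv_pow, Units.val_inv_eq_inv_val, Units.val_pow_eq_pow_val,
    Units.val_mk0, hk2, Units.val_div_eq_div_val, Units.val_mul]
  field_simp

/-- The degree of a multiquadratic extension is the number of square classes generated by the
elements whose square roots are adjoined. -/
theorem finrank_adjoin_of_sq_mem_range [CharZero K] (S : Set L) (hfin : S.Finite)
    (hS : ∀ s ∈ S, s ^ 2 ∈ Set.range (algebraMap K L)) :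
    finrank K (adjoin K S) =
      Nat.card (Subgroup.closure {q : Kˣ ⧸ (powMonoidHom 2 : Kˣ →* Kˣ).range |
        ∃ u : Kˣ, (∃ s ∈ S, s ^ 2 = algebraMap K L u) ∧ q = QuotientGroup.mk u}) := by
  set M := Subgroup.closure {q : Kˣ ⧸ (powMonoidHom 2 : Kˣ →* Kˣ).range |
        ∃ u : Kˣ, (∃ s ∈ S, s ^ 2 = algebraMap K L u) ∧ q = QuotientGroup.mk u} with hM
  have hint : ∀ s ∈ S, IsIntegral K s := fun s hs => isIntegral_of_sq_mem_range (hS s hs)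
  have : FiniteDimensional K (adjoin K S) := by
    have := hfin.to_subtype
    exact finiteDimensional_adjoin hint
  have := isGalois_adjoin_of_sq_mem_range S hS
  have hroot : ∀ q ∈ M, ∃ (u : Kˣ) (b : adjoin K S), b ^ 2 = algebraMap K (adjoin K S) u ∧
      QuotientGroup.mk u = q := by
    intro q hq
    induction hq using Subgroup.closure_induction with
    | mem q hq =>
      obtain ⟨u, ⟨s, hs, hsu⟩, rfl⟩ := hq
      exact ⟨u, ⟨s, subset_adjoin K S hs⟩, Subtype.ext hsu, rfl⟩
    | one => exact ⟨1, 1, by simp, rfl⟩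
    | mul q q' _ _ h h' =>
      obtain ⟨u, b, hb, rfl⟩ := h
      obtain ⟨u', b', hb', rfl⟩ := h'
      exact ⟨u * u', b * b', by rw [mul_pow, hb, hb', Units.val_mul, map_mul], rfl⟩
    | inv q _ h =>
      obtain ⟨u, b, hb, rfl⟩ := h
      exact ⟨u⁻¹, b⁻¹, by rw [inv_pow, hb, Units.val_inv_eq_inv_val, map_inv₀], rfl⟩
  choose u r hr hu using fun q : M => hroot q q.2
  have hr0 : ∀ q, r q ≠ 0 := fun q h0 => by
    have := hr q
    rw [h0, zero_pow two_ne_zero, eq_comm, map_eq_zero] at this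
    exact (u q).ne_zero this
  have hli : LinearIndependent K r :=
    linearIndependent_of_sq_mem_range r hr0 (fun q => ⟨_, (hr q).symm⟩) fun q q' h =>
      Subtype.ext <| by rw [← hu q, ← hu q']; exact mk_eq_of_div_mem_range (hr q) (hr q') h
  have hmem : ∀ (q : M) (v : Kˣ) (b : adjoin K S), b ^ 2 = algebraMap K (adjoin K S) v →
      QuotientGroup.mk v = (q : Kˣ ⧸ (powMonoidHom 2 : Kˣ →* Kˣ).range) →
      b ∈ Submodule.span K (Set.range r) := fun q v b hb hq => by
    obtain ⟨k, hk⟩ := exists_eq_algebraMap_mul_of_mk_eq hb (hr q) (hq.trans (hu q).symm)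
    rw [hk, ← Algebra.smul_def]
    exact Submodule.smul_mem _ _ (Submodule.subset_span ⟨q, rfl⟩)
  let P : Subalgebra K (adjoin K S) := (Submodule.span K (Set.range r)).toSubalgebra
    (hmem 1 1 1 (by simp) rfl) fun x y hx hy => by
      induction hx, hy using Submodule.span_induction₂ with
      | mem_mem x y hx hy =>
        obtain ⟨q, rfl⟩ := hx
        obtain ⟨q', rfl⟩ := hy
        refine hmem (q * q') (u q * u q') _ ?_ ?_
        · rw [mul_pow, hr, hr, Units.val_mul, map_mul]
        · rw [QuotientGroup.mk_mul, hu, hu]; rfl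
      | zero_left y hy => simp
      | zero_right x hx => simp
      | add_left x y z _ _ _ hx hy => rw [add_mul]; exact Submodule.add_mem _ hx hy
      | add_right x y z _ _ _ hx hy => rw [mul_add]; exact Submodule.add_mem _ hx hy
      | smul_left k x y _ _ h => rw [smul_mul_assoc]; exact Submodule.smul_mem _ _ h
      | smul_right k x y _ _ h => rw [mul_smul_comm]; exact Submodule.smul_mem _ _ h
  have hspan : ⊤ ≤ Submodule.span K (Set.range r) := by
    have hle : Algebra.adjoin K S ≤ P.map (adjoin K S).val := Algebra.adjoin_le fun s hs => by
      refine ⟨⟨s, subset_adjoin K S hs⟩, ?_, rfl⟩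
      obtain ⟨k, hk⟩ := hS s hs
      by_cases hk0 : k = 0
      · have : s = 0 := by simpa [hk0] using hk.symm
        subst this
        exact P.zero_mem
      · exact hmem ⟨_, Subgroup.subset_closure ⟨Units.mk0 k hk0, ⟨s, hs, hk.symm⟩, rfl⟩⟩
          (Units.mk0 k hk0) _ (Subtype.ext hk.symm) rfl
    intro x _
    have hx : (x : L) ∈ Algebra.adjoin K S := by
      rw [← adjoin_toSubalgebra_of_isAlgebraic fun s hs => (hint s hs).isAlgebraic]
      exact x.2
    obtain ⟨y, hy, hyx⟩ := hle hx
    rwa [← show y = x from Subtype.ext hyx]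
  exact finrank_eq_nat_card_basis (Basis.mk hli hspan)

end MultiquadraticExtensions

theorem disjoint_multiset_sub_sub {α : Type*} [DecidableEq α] (A B : Multiset α) :
    Disjoint (A - B) (B - A) := by
  refine Multiset.disjoint_left.2 fun {g} hA hB => ?_
  have hA := Multiset.count_pos.2 hA
  have hB := Multiset.count_pos.2 hB
  rw [Multiset.count_sub] at hA hB
  omega

section PowerMap

variable {G : Type*} [CommGroup G] [Fintype G]

theorem pow_val_unit_injective (t : (ZMod (Monoid.exponent G))ˣ) :
    Function.Injective fun x : G => x ^ (t : ZMod (Monoid.exponent G)).val := by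
  have : NeZero (Monoid.exponent G) := ⟨Monoid.exponent_ne_zero_of_finite⟩
  have hinv : ∀ x : G, (x ^ (t : ZMod (Monoid.exponent G)).val) ^
      ((t⁻¹ : (ZMod (Monoid.exponent G))ˣ) : ZMod (Monoid.exponent G)).val = x := fun x => by
    rw [← pow_mul]
    conv_rhs => rw [← pow_one x]
    rw [pow_eq_pow_iff_modEq]
    refine Nat.ModEq.of_dvd (Monoid.order_dvd_exponent x) ?_
    rw [← ZMod.natCast_eq_natCast_iff]
    simp
  exact Function.LeftInverse.injective hinv

theorem charSumHom_msPow_sub_eq_iff [DecidableEq G] (t : (ZMod (Monoid.exponent G))ˣ)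
    {A B : Multiset G} (h : Disjoint A B) :
    (∀ χ, charSumHom χ (msPow t A) - charSumHom χ (msPow t B) =
      charSumHom χ A - charSumHom χ B) ↔ msPow t A = A ∧ msPow t B = B := by
  refine ⟨fun hχ => ?_, fun ⟨hA, hB⟩ χ => by rw [hA, hB]⟩
  have hadd : msPow t A + B = A + msPow t B := multiset_eq_of_charSumHom_eq fun χ => by
    rw [charSumHom_add, charSumHom_add]
    linear_combination hχ χ
  have ht : Disjoint (msPow t A) (msPow t B) := Multiset.disjoint_map_map.2 fun a ha b hb hab =>
    Multiset.disjoint_left.1 h ha (pow_val_unit_injective t hab ▸ hb)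
  have key : ∀ g, (msPow t A).count g = A.count g ∧ (msPow t B).count g = B.count g := fun g => by
    have h1 := congrArg (Multiset.count g) hadd
    have h2 : A.count g = 0 ∨ B.count g = 0 := by
      by_contra! hne
      exact Multiset.disjoint_left.1 h (Multiset.count_ne_zero.1 hne.1)
        (Multiset.count_ne_zero.1 hne.2)
    have h3 : (msPow t A).count g = 0 ∨ (msPow t B).count g = 0 := by
      by_contra! hne
      exact Multiset.disjoint_left.1 ht (Multiset.count_ne_zero.1 hne.1)
        (Multiset.count_ne_zero.1 hne.2)
    simp only [Multiset.count_add] at h1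
    omega
  exact ⟨Multiset.ext.2 fun g => (key g).1, Multiset.ext.2 fun g => (key g).2⟩

end PowerMap

section FixingSubgroup

open Module

theorem finrank_adjoin_image_mul_card_fixing {k L : Type*} [Field k] [Field L] [Algebra k L]
    (F : IntermediateField k L) [FiniteDimensional k F] [IsGalois k F] (S : Set F) :
    finrank k (adjoin k (F.val '' S)) * Nat.card {σ : Gal(F/k) | ∀ s ∈ S, σ s = s} =
      finrank k F := by
  have h1 : finrank k (adjoin k (F.val '' S)) = finrank k (adjoin k S) := by
    rw [← adjoin_map]
    exact ((adjoin k S).equivMap F.val).toLinearEquiv.finrank_eq.symm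
  have h2 : {σ : Gal(F/k) | ∀ s ∈ S, σ s = s} = (adjoin k S).fixingSubgroup := by
    ext σ
    rw [SetLike.mem_coe, ← Subgroup.zpowers_le, ← le_iff_le, adjoin_le_iff]
    refine forall₂_congr fun s _ => ?_
    rw [SetLike.mem_coe, mem_fixedField_iff]
    refine ⟨fun h τ hτ => ?_, fun h => h σ (Subgroup.mem_zpowers σ)⟩
    have : Subgroup.zpowers σ ≤ MulAction.stabilizer Gal(F/k) s := by simpa using h
    exact this hτ
  rw [h1, h2]
  change _ * Nat.card (adjoin k S).fixingSubgroup = _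
  rw [IsGalois.card_fixingSubgroup_eq_finrank, finrank_mul_finrank]

theorem autEquivPow_spec {n : ℕ} [NeZero n] {k L : Type*} [Field k] [Field L] [Algebra k L]
    [IsCyclotomicExtension {n} k L] (h : Irreducible (Polynomial.cyclotomic n k)) (σ : Gal(L/k))
    {w : L} (hw : w ^ n = 1) :
    σ w = w ^ (IsCyclotomicExtension.autEquivPow L h σ : ZMod n).val := by
  have hζ := IsCyclotomicExtension.zeta_spec n k L
  obtain ⟨i, -, rfl⟩ := hζ.eq_pow_of_pow_eq_one hw
  rw [map_pow, ← hζ.autToPow_spec k σ, pow_right_comm]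
  rfl

end FixingSubgroup

section CharacterFields

open Module

variable {k : Type*} [Field k] [Algebra k ℂ] {G : Type*} [CommGroup G]

theorem coe_galois_charSumHom (F : IntermediateField k ℂ)
    [NeZero (Monoid.exponent G)] [IsCyclotomicExtension {Monoid.exponent G} k F]
    (h : Irreducible (Polynomial.cyclotomic (Monoid.exponent G) k)) (σ : Gal(F/k))
    (hF : ∀ (χ : G →* ℂˣ) g, (χ g : ℂ) ∈ F) (χ : G →* ℂˣ) (X : Multiset G) :
    ((σ (X.map fun g => (⟨χ g, hF χ g⟩ : F)).sum : F) : ℂ) =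
      charSumHom χ (msPow (IsCyclotomicExtension.autEquivPow F h σ) X) := by
  change F.val _ = _
  rw [map_multiset_sum, map_multiset_sum, charSumHom, msPow, Multiset.map_map, Multiset.map_map,
    Multiset.map_map]
  congr 1
  refine Multiset.map_congr rfl fun g _ => ?_
  have hw : (⟨χ g, hF χ g⟩ : F) ^ Monoid.exponent G = 1 := Subtype.ext <| by
    simp [← Units.val_pow_eq_pow_val, ← map_pow, Monoid.pow_exponent_eq_one]
  simp [autEquivPow_spec h σ hw]

theorem finrank_adjoin_charSumHom_mul_card [Fintype G] [DecidableEq G] (I A B : Multiset G)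
    (hAB : Disjoint A B)
    (hirr : Irreducible (Polynomial.cyclotomic (Monoid.exponent G) k)) :
    finrank k (adjoin k ({z : ℂ | ∃ χ : G →* ℂˣ, z = charSumHom χ I} ∪
        {z : ℂ | ∃ χ : G →* ℂˣ, z = charSumHom χ A - charSumHom χ B})) *
      Nat.card {t : (ZMod (Monoid.exponent G))ˣ |
        msPow t I = I ∧ msPow t A = A ∧ msPow t B = B} =
      Nat.totient (Monoid.exponent G) := by
  have hne : NeZero (Monoid.exponent G) := ⟨Monoid.exponent_ne_zero_of_finite⟩
  have hζ := Complex.isPrimitiveRoot_exp (Monoid.exponent G) hne.out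
  set ζ := Complex.exp (2 * Real.pi * Complex.I / (Monoid.exponent G : ℕ))
  set F : IntermediateField k ℂ := adjoin k {ζ} with hFdef
  have hcyc : IsCyclotomicExtension {Monoid.exponent G} k F := by
    change IsCyclotomicExtension {Monoid.exponent G} k F.toSubalgebra
    rw [hFdef, adjoin_simple_toSubalgebra_of_isAlgebraic
      (hζ.isIntegral (NeZero.pos _)).tower_top.isAlgebraic]
    exact hζ.adjoin_isCyclotomicExtension k
  have hfd : FiniteDimensional k F := IsCyclotomicExtension.finiteDimensional {Monoid.exponent G} k F
  have hgal : IsGalois k F := IsCyclotomicExtension.isGalois {Monoid.exponent G} k F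
  have hF : ∀ (χ : G →* ℂˣ) g, (χ g : ℂ) ∈ F := fun χ g => by
    have hw : (χ g : ℂ) ^ Monoid.exponent G = 1 := by
      simp [← Units.val_pow_eq_pow_val, ← map_pow, Monoid.pow_exponent_eq_one]
    obtain ⟨i, -, hi⟩ := hζ.eq_pow_of_pow_eq_one hw
    rw [← hi]
    exact pow_mem (mem_adjoin_simple_self k ζ) i
  let c : (G →* ℂˣ) → Multiset G → F := fun χ X => (X.map fun g => (⟨χ g, hF χ g⟩ : F)).sum
  have hc : ∀ χ X, (c χ X : ℂ) = charSumHom χ X := fun χ X => by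
    change F.val _ = _
    rw [map_multiset_sum, Multiset.map_map]
    rfl
  let S : Set F := (Set.range fun χ => c χ I) ∪ Set.range fun χ => c χ A - c χ B
  have hS : ({z : ℂ | ∃ χ : G →* ℂˣ, z = charSumHom χ I} ∪
      {z : ℂ | ∃ χ : G →* ℂˣ, z = charSumHom χ A - charSumHom χ B}) = F.val '' S := by
    rw [Set.image_union, ← Set.range_comp, ← Set.range_comp]
    ext z
    simp [hc, eq_comm]
  rw [hS, ← IsCyclotomicExtension.finrank F hirr, ← finrank_adjoin_image_mul_card_fixing F S]
  congr 1
  refine (Nat.card_congr ((IsCyclotomicExtension.autEquivPow F hirr).toEquiv.subtypeEquiv ?_)).symm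
  intro σ
  rw [Set.mem_ofPred_eq, Set.mem_ofPred_eq, MulEquiv.toEquiv_eq_coe, EquivLike.coe_coe,
    ← charSumHom_msPow_sub_eq_iff _ hAB]
  have hσ := coe_galois_charSumHom F hirr σ hF
  constructor
  · intro h
    refine ⟨multiset_eq_of_charSumHom_eq fun χ => ?_, fun χ => ?_⟩
    · rw [← hσ, ← hc, h _ (Or.inl ⟨χ, rfl⟩)]
    · have := congrArg (fun x : F => (x : ℂ)) (h _ (Or.inr ⟨χ, rfl⟩))
      simp only [map_sub, AddSubgroupClass.coe_sub, hc] at this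
      rw [← hσ, ← hσ]
      exact this
  · rintro ⟨h1, h2⟩ s (⟨χ, rfl⟩ | ⟨χ, rfl⟩)
    · refine Subtype.ext ((hσ χ I).trans ?_)
      rw [h1, hc]
    · refine Subtype.ext ?_
      simp only [map_sub, AddSubgroupClass.coe_sub, hc]
      rw [← h2, ← hσ, ← hσ]

end CharacterFields

section Discriminants

variable {G : Type*} [CommGroup G]

theorem charSumHom_discriminant (T11 T22 T12 T21 : Finset G) (χ : G →* ℂˣ) :
    charSumHom χ (msProd T11.val T11.val + msProd T22.val T22.val + 4 • msProd T12.val T21.val) -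
      charSumHom χ (2 • msProd T11.val T22.val) =
    (charSumHom χ T11.val - charSumHom χ T22.val) ^ 2 +
      4 * (charSumHom χ T12.val * charSumHom χ T21.val) := by
  simp only [charSumHom_add, charSumHom_nsmul, charSumHom_msProd]
  push_cast
  ring

theorem aeval_charpoly_scMatrix_half_eq_zero [Fintype G] [DecidableEq G]
    {T11 T22 T12 T21 : Finset G} {χ : G →* ℂˣ} {s : ℂ}
    (hs : s ^ 2 = (charSumHom χ T11.val - charSumHom χ T22.val) ^ 2 +
      4 * (charSumHom χ T12.val * charSumHom χ T21.val)) :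
    Polynomial.aeval ((charSumHom χ (T11.val + T22.val) + s) / 2)
      (scMatrix T11 T22 T12 T21).charpoly = 0 := by
  refine (aeval_charpoly_scMatrix_eq_zero_iff _ _ _ _ _).2 ⟨χ, ?_⟩
  rw [charSumHom_add]
  linear_combination hs / 4

theorem exists_sq_eq_of_aeval_charpoly_scMatrix_eq_zero [Fintype G] [DecidableEq G]
    {T11 T22 T12 T21 : Finset G} {z : ℂ}
    (hz : Polynomial.aeval z (scMatrix T11 T22 T12 T21).charpoly = 0) :
    ∃ χ : G →* ℂˣ, (2 * z - charSumHom χ (T11.val + T22.val)) ^ 2 =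
      (charSumHom χ T11.val - charSumHom χ T22.val) ^ 2 +
        4 * (charSumHom χ T12.val * charSumHom χ T21.val) := by
  obtain ⟨χ, hχ⟩ := (aeval_charpoly_scMatrix_eq_zero_iff _ _ _ _ _).1 hz
  refine ⟨χ, ?_⟩
  rw [charSumHom_add]
  linear_combination 4 * hχ

theorem finite_setOf_exists_sq_eq {ι : Type*} [Finite ι] (f : ι → ℂ) :
    {z : ℂ | ∃ i, z ^ 2 = f i}.Finite := by
  have : {z : ℂ | ∃ i, z ^ 2 = f i} = ⋃ i, {z : ℂ | z ^ 2 = f i} := by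
    ext z
    simp
  rw [this]
  refine Set.finite_iUnion fun i => ?_
  obtain ⟨w, hw⟩ := IsAlgClosed.exists_pow_nat_eq (f i) two_pos
  refine (Set.toFinite {w, -w}).subset fun z hz => ?_
  exact sq_eq_sq_iff_eq_or_eq_neg.1 (hz.trans hw.symm)

theorem finite_characters [Finite G] : Finite (G →* ℂˣ) := by
  have : NeZero (Monoid.exponent G) := ⟨Monoid.exponent_ne_zero_of_finite⟩
  infer_instance

end Discriminants

theorem stmt_13 {G : Type*} [CommGroup G] [Fintype G] [DecidableEq G]
    (T11 T22 T12 T21 : Finset G)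
    (I1 I2 I3 : Multiset G)
    (hI1 : I1 = T11.val + T22.val)
    (hI2 : I2 = msProd T11.val T11.val + msProd T22.val T22.val + 4 • msProd T12.val T21.val)
    (hI3 : I3 = 2 • msProd T11.val T22.val)
    (SF : IntermediateField ℚ ℂ)
    (hSF : SF = IntermediateField.adjoin ℚ
      {z : ℂ | Polynomial.aeval z (scMatrix T11 T22 T12 T21).charpoly = 0})
    (K : IntermediateField ℚ ℂ)
    (hK : K = IntermediateField.adjoin ℚ
      ({z : ℂ | ∃ χ : G →* ℂˣ, z = charSumHom χ I1}
        ∪ {z : ℂ | ∃ χ : G →* ℂˣ,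
            z = charSumHom χ (I2 - I3) - charSumHom χ (I3 - I2)}))
    (T : Set (ZMod (Monoid.exponent G))ˣ)
    (hT : T = {t | msPow t I1 = I1 ∧ msPow t (I2 - I3) = I2 - I3
        ∧ msPow t (I3 - I2) = I3 - I2})
    (hvals : ∀ χ : G →* ℂˣ, charSumHom χ (I2 - I3) - charSumHom χ (I3 - I2) ∈ K)
    (M : Subgroup ((↥K)ˣ ⧸ (powMonoidHom 2 : (↥K)ˣ →* (↥K)ˣ).range))
    (hM : M = Subgroup.closure
      {q | ∃ (χ : G →* ℂˣ)
          (hne : (⟨charSumHom χ (I2 - I3) - charSumHom χ (I3 - I2), hvals χ⟩ : ↥K) ≠ 0),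
        q = QuotientGroup.mk (Units.mk0 _ hne)}) :
    SF = IntermediateField.restrictScalars ℚ
        (IntermediateField.adjoin ↥K
          {z : ℂ | ∃ χ : G →* ℂˣ,
            z ^ 2 = charSumHom χ (I2 - I3) - charSumHom χ (I3 - I2)})
      ∧ Module.finrank ℚ ↥SF * Nat.card T
          = Nat.totient (Monoid.exponent G) * Nat.card ↥M := by
  have hD : ∀ χ : G →* ℂˣ, charSumHom χ (I2 - I3) - charSumHom χ (I3 - I2) =
      (charSumHom χ T11.val - charSumHom χ T22.val) ^ 2 +
        4 * (charSumHom χ T12.val * charSumHom χ T21.val) := fun χ => by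
    rw [charSumHom_sub_sub, hI2, hI3, charSumHom_discriminant]
  have hI1K : ∀ χ : G →* ℂˣ, charSumHom χ I1 ∈ K := fun χ => by
    rw [hK]
    exact subset_adjoin _ _ (Or.inl ⟨χ, rfl⟩)
  have hroot : ∀ (χ : G →* ℂˣ) (s : ℂ),
      s ^ 2 = charSumHom χ (I2 - I3) - charSumHom χ (I3 - I2) →
        charSumHom χ I1 ∈ SF ∧ s ∈ SF := fun χ s hs => by
    have hmem : ∀ w : ℂ, w ^ 2 = charSumHom χ (I2 - I3) - charSumHom χ (I3 - I2) →
        (charSumHom χ I1 + w) / 2 ∈ SF := fun w hw => by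
      rw [hSF, hI1]
      exact subset_adjoin _ _ (aeval_charpoly_scMatrix_half_eq_zero (hw.trans (hD χ)))
    have h1 := hmem s hs
    have h2 := hmem (-s) (by rw [neg_sq, hs])
    constructor
    · convert SF.add_mem h1 h2 using 1
      ring
    · convert SF.sub_mem h1 h2 using 1
      ring
  have hKSF : K ≤ SF := by
    rw [hK, adjoin_le_iff]
    rintro z (⟨χ, rfl⟩ | ⟨χ, rfl⟩) <;>
      obtain ⟨s, hs⟩ := IsAlgClosed.exists_pow_nat_eq
        (charSumHom χ (I2 - I3) - charSumHom χ (I3 - I2)) two_pos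
    · exact (hroot χ s hs).1
    · rw [← hs]
      exact SF.pow_mem (hroot χ s hs).2 2
  set S : Set ℂ := {z : ℂ | ∃ χ : G →* ℂˣ,
    z ^ 2 = charSumHom χ (I2 - I3) - charSumHom χ (I3 - I2)} with hS
  have hfield : SF = restrictScalars ℚ (adjoin K S) := by
    apply le_antisymm
    · rw [hSF, adjoin_le_iff]
      intro z hz
      obtain ⟨χ, hχ⟩ := exists_sq_eq_of_aeval_charpoly_scMatrix_eq_zero hz
      rw [← hD, ← hI1] at hχ
      have h1 : 2 * z - charSumHom χ I1 ∈ adjoin K S := subset_adjoin _ _ ⟨χ, hχ⟩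
      have h2 : charSumHom χ I1 ∈ adjoin K S :=
        (adjoin K S).algebraMap_mem ⟨charSumHom χ I1, hI1K χ⟩
      have h3 : (2 : ℂ) ∈ adjoin K S := ofNat_mem _ 2
      rw [SetLike.mem_coe, mem_restrictScalars]
      convert (adjoin K S).div_mem ((adjoin K S).add_mem h1 h2) h3 using 1
      ring
    · have : adjoin K S ≤ extendScalars hKSF := by
        rw [adjoin_le_iff]
        rintro z ⟨χ, hχ⟩
        exact (hroot χ z hχ).2
      exact fun x hx => this hx
  refine ⟨hfield, ?_⟩
  have hfinite := finite_characters (G := G)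
  have hM' : Module.finrank K (adjoin K S) = Nat.card M := by
    rw [finrank_adjoin_of_sq_mem_range S (finite_setOf_exists_sq_eq _)
      (by rintro s ⟨χ, hs⟩; exact ⟨⟨_, hvals χ⟩, hs.symm⟩), hM]
    refine congrArg (fun s => Nat.card (Subgroup.closure s)) ?_
    ext q
    constructor
    · rintro ⟨u, ⟨s, ⟨χ, hs⟩, hsu⟩, rfl⟩
      have hu : (u : K) = ⟨charSumHom χ (I2 - I3) - charSumHom χ (I3 - I2), hvals χ⟩ :=
        Subtype.ext (hsu.symm.trans hs)
      exact ⟨χ, hu ▸ u.ne_zero, congrArg _ (Units.ext hu)⟩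
    · rintro ⟨χ, hne, rfl⟩
      obtain ⟨s, hs⟩ := IsAlgClosed.exists_pow_nat_eq
        (charSumHom χ (I2 - I3) - charSumHom χ (I3 - I2)) two_pos
      exact ⟨Units.mk0 _ hne, ⟨s, ⟨χ, hs⟩, hs⟩, rfl⟩
  have hT' := finrank_adjoin_charSumHom_mul_card I1 _ _ (disjoint_multiset_sub_sub I2 I3)
    (Polynomial.cyclotomic.irreducible_rat
      (Nat.pos_of_ne_zero Monoid.exponent_ne_zero_of_finite))
  rw [← hK, ← hT] at hT'
  have htower : Module.finrank ℚ SF = Module.finrank ℚ K * Nat.card M := by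
    rw [← hM', hfield]
    exact (Module.finrank_mul_finrank ℚ K (adjoin K S)).symm
  rw [htower, ← hT']
  ring
end

section
/- Let G be a finite group and let Γ = SC(G, T₁₁, T₂₂, T₁₂, T₂₁) be a quasi-abelian semi-Cayley digraph with T₁₁ = T₂₂, T₁₂ = T₂₁ and T₁₂ = T₁₂⁻¹ (where T₁₂⁻¹ = {x⁻¹ : x ∈ T₁₂}), with adjacency matrix A as below. Then the splitting field SF(Γ) — the subfield of ℂ generated over ℚ by all complex roots of the characteristic polynomial of A — equals the subfield of ℂ generated over ℚ by all the values χ(T₁₁) and χ(T₁₂), χ ranging over the irreducible complex characters of G. -/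
open IntermediateField

/-- A finset of elements of a group is conjugation-closed if its image under
conjugation by any group element equals itself. -/
def ConjClosedF {G : Type*} [Group G] [DecidableEq G] (T : Finset G) : Prop :=
  ∀ g : G, T.image (fun x => g⁻¹ * x * g) = T

/-- `χ : G → ℂ` is an irreducible complex character of `G` if it is the trace function of
a nonzero irreducible finite-dimensional complex representation of `G`. -/
def IsIrrChar (G : Type*) [Group G] (χ : G → ℂ) : Prop :=
  ∃ (V : Type) (_ : AddCommGroup V) (_ : Module ℂ V) (_ : FiniteDimensional ℂ V)
    (_ : Nontrivial V) (ρ : Representation ℂ G V),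
    (∀ W : Submodule ℂ V, (∀ g : G, ∀ v ∈ W, ρ g v ∈ W) → W = ⊥ ∨ W = ⊤) ∧
    ∀ g : G, χ g = LinearMap.trace ℂ V (ρ g)

/-- Summing over left and over right translates by a conjugation-closed set is the same. -/
theorem ConjClosedF.sum_mul_comm {G M : Type*} [Group G] [DecidableEq G] [AddCommMonoid M]
    {T : Finset G} (hT : ConjClosedF T) (f : G → M) (h : G) :
    ∑ s ∈ T, f (s * h) = ∑ s ∈ T, f (h * s) := by
  conv_rhs => rw [← hT h]
  rw [Finset.sum_image (fun x _ y _ hxy => by simpa using hxy)]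
  simp [mul_assoc]

/-- If `∑ a g • ρ g` acts as the scalar `z` on a nonzero invariant subspace, then `z` is
the corresponding normalised weighted sum of some irreducible character. -/
theorem exists_isIrrChar_of_invariant {G M : Type*} [Group G] [Fintype G] [AddCommGroup M]
    [Module ℂ M] [FiniteDimensional ℂ M] (ρ : Representation ℂ G M) (a : G → ℂ) (z : ℂ)
    (E : Submodule ℂ M) (hE : E ≠ ⊥) (hinv : ∀ g, ∀ v ∈ E, ρ g v ∈ E)
    (hz : ∀ v ∈ E, ∑ g, a g • ρ g v = z • v) :
    ∃ χ : G → ℂ, IsIrrChar G χ ∧ ∃ n : ℕ, n ≠ 0 ∧ ∑ g, a g * χ g = z * n := by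
  obtain ⟨W, ⟨hW0, hWE, hWinv⟩, hWmin⟩ := (wellFounded_lt (α := Submodule ℂ M)).has_min
    {W | W ≠ ⊥ ∧ W ≤ E ∧ ∀ g, ∀ v ∈ W, ρ g v ∈ W} ⟨E, hE, le_rfl, hinv⟩
  let e : (Fin (Module.finrank ℂ W) → ℂ) ≃ₗ[ℂ] W := (Module.finBasis ℂ W).equivFun.symm
  let σ : Representation ℂ G (Fin (Module.finrank ℂ W) → ℂ) :=
    { toFun := fun g => e.symm.toLinearMap ∘ₗ (ρ g).restrict (hWinv g) ∘ₗ e.toLinearMap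
      map_one' := by
        refine LinearMap.ext fun x => ?_
        simp [LinearMap.restrict_apply]
      map_mul' := fun g h => by
        refine LinearMap.ext fun x => ?_
        simp [LinearMap.restrict_apply] }
  have hσ : ∀ g x, ((e (σ g x) : W) : M) = ρ g (e x) := fun g x => by
    simp [σ]
  have hWnt : Nontrivial W := Submodule.nontrivial_iff_ne_bot.mpr hW0
  have hn : Module.finrank ℂ W ≠ 0 := Module.finrank_pos.ne'
  refine ⟨fun g => LinearMap.trace ℂ _ (σ g), ⟨_, inferInstance, inferInstance, inferInstance,
    e.toEquiv.nontrivial, σ, fun U hU => ?_, fun g => rfl⟩, Module.finrank ℂ W, hn, ?_⟩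
  · by_cases hU0 : U = ⊥
    · exact Or.inl hU0
    right
    let j : (Fin (Module.finrank ℂ W) → ℂ) →ₗ[ℂ] M := W.subtype ∘ₗ e.toLinearMap
    have hj : Function.Injective j := W.subtype_injective.comp e.injective
    have hle : U.map j ≤ W := by
      rintro _ ⟨x, -, rfl⟩
      exact (e x).2
    have hmem : U.map j ≠ ⊥ ∧ U.map j ≤ E ∧ ∀ g, ∀ v ∈ U.map j, ρ g v ∈ U.map j := by
      refine ⟨fun h => hU0 (Submodule.map_injective_of_injective hj (by rw [h, Submodule.map_bot])), hle.trans hWE, ?_⟩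
      rintro g _ ⟨x, hx, rfl⟩
      exact ⟨σ g x, hU g x hx, hσ g x⟩
    have heq : U.map j = W := by
      by_contra hne
      exact hWmin _ hmem (lt_of_le_of_ne hle hne)
    refine eq_top_iff.2 fun x _ => ?_
    have hx : j x ∈ U.map j := by
      rw [heq]
      exact (e x).2
    obtain ⟨y, hy, hyx⟩ := hx
    exact hj hyx ▸ hy
  · have key : ∑ g, a g • σ g = z • LinearMap.id := by
      refine LinearMap.ext fun x => e.injective (Subtype.ext ?_)
      simpa [hσ] using hz (e x) (hWE (e x).2)
    have := congrArg (LinearMap.trace ℂ _) key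
    simpa using this

/-- A conjugation-closed sum acts on an irreducible representation as a scalar. -/
theorem ConjClosedF.exists_sum_eq_smul {G V : Type*} [Group G] [DecidableEq G] [AddCommGroup V]
    [Module ℂ V] [FiniteDimensional ℂ V] [Nontrivial V] {T : Finset G} (hT : ConjClosedF T)
    (ρ : Representation ℂ G V)
    (hirr : ∀ W : Submodule ℂ V, (∀ g : G, ∀ v ∈ W, ρ g v ∈ W) → W = ⊥ ∨ W = ⊤) :
    ∃ c : ℂ, ∑ s ∈ T, ρ s = c • LinearMap.id := by
  obtain ⟨c, hc⟩ := Module.End.exists_eigenvalue (∑ s ∈ T, ρ s : Module.End ℂ V)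
  have hcomm : ∀ g, (∑ s ∈ T, ρ s) * ρ g = ρ g * ∑ s ∈ T, ρ s := fun g => by
    simpa [Finset.sum_mul, Finset.mul_sum] using hT.sum_mul_comm (fun x => ρ x) g
  refine ⟨c, LinearMap.ext fun v => ?_⟩
  have htop := (hirr (Module.End.eigenspace (∑ s ∈ T, ρ s : Module.End ℂ V) c)
    fun g v hv => ?_).resolve_left hc
  · have hv : v ∈ Module.End.eigenspace (∑ s ∈ T, ρ s : Module.End ℂ V) c := htop ▸ trivial
    exact Module.End.mem_eigenspace_iff.1 hv
  · rw [Module.End.mem_eigenspace_iff] at hv ⊢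
    rw [← Module.End.mul_apply, hcomm, Module.End.mul_apply, hv, map_smul]

/-- The roots of the characteristic polynomial of `SC(G, T, T, S, S)` are the eigenvalues of the
corresponding translation operator on pairs of functions. -/
theorem aeval_charpoly_scMatrix_eq_zero_iff_s16 {G : Type*} [Group G] [Fintype G] [DecidableEq G]
    (T S : Finset G) (z : ℂ) :
    Polynomial.aeval z (scMatrix T T S S).charpoly = 0 ↔
      ∃ u v : G → ℂ, (u ≠ 0 ∨ v ≠ 0) ∧
        (∀ h, ∑ s ∈ T, u (s * h) + ∑ s ∈ S, v (s * h) = z * u h) ∧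
        (∀ h, ∑ s ∈ S, u (s * h) + ∑ s ∈ T, v (s * h) = z * v h) := by
  have hsum : ∀ (X : Finset G) (f : G → ℂ) (h : G),
      ∑ g, (if g * h⁻¹ ∈ X then f g else 0) = ∑ s ∈ X, f (s * h) := fun X f h => by
    rw [← Equiv.sum_comp (Equiv.mulRight h)]
    simp
  rw [← Polynomial.eval_map_algebraMap, ← Matrix.charpoly_map, Matrix.eval_charpoly,
    ← Matrix.exists_mulVec_eq_zero_iff]
  have hmul : ∀ w : G ⊕ G → ℂ,
      (Matrix.scalar _ z - (scMatrix T T S S).map (algebraMap ℚ ℂ)).mulVec w = 0 ↔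
        (∀ h, ∑ s ∈ T, w (.inl (s * h)) + ∑ s ∈ S, w (.inr (s * h)) = z * w (.inl h)) ∧
        (∀ h, ∑ s ∈ S, w (.inl (s * h)) + ∑ s ∈ T, w (.inr (s * h)) = z * w (.inr h)) := by
    intro w
    rw [Matrix.sub_mulVec, sub_eq_zero, eq_comm, funext_iff, Sum.forall]
    simp [Matrix.mulVec, dotProduct, scMatrix, apply_ite, ite_mul, Matrix.diagonal_apply,
      hsum _ (fun g => w (.inl g)), hsum _ (fun g => w (.inr g))]
  constructor
  · rintro ⟨w, hw0, hw⟩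
    refine ⟨fun g => w (.inl g), fun g => w (.inr g), ?_, (hmul w).1 hw⟩
    by_contra! hcon
    exact hw0 (funext (Sum.forall.2 ⟨congrFun hcon.1, congrFun hcon.2⟩))
  · rintro ⟨u, v, h0, h1, h2⟩
    refine ⟨Sum.elim u v, fun h => ?_, (hmul _).2 ⟨h1, h2⟩⟩
    rcases h0 with h0 | h0
    · exact h0 (funext fun g => congrFun h (.inl g))
    · exact h0 (funext fun g => congrFun h (.inr g))

/-- An eigenvalue of the operator `f ↦ ∑_{s ∈ T} f(s ·) + ε ∑_{s ∈ S} f(s ·)` is a normalised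
combination of values of an irreducible character. -/
theorem ConjClosedF.exists_isIrrChar_of_eigenvector {G : Type*} [Group G] [Fintype G]
    [DecidableEq G] {T S : Finset G} (hT : ConjClosedF T) (hS : ConjClosedF S) (ε z : ℂ)
    (f : G → ℂ) (hf0 : f ≠ 0)
    (hf : ∀ h, ∑ s ∈ T, f (s * h) + ε * ∑ s ∈ S, f (s * h) = z * f h) :
    ∃ χ : G → ℂ, IsIrrChar G χ ∧
      ∃ n : ℕ, n ≠ 0 ∧ ∑ s ∈ T, χ s + ε * ∑ s ∈ S, χ s = z * n := by
  let R : Representation ℂ G (G → ℂ) :=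
    { toFun := fun g => LinearMap.funLeft ℂ ℂ (· * g)
      map_one' := by ext; simp [LinearMap.funLeft]
      map_mul' := fun g h => by
        refine LinearMap.ext fun x => funext fun y => ?_
        simp [LinearMap.funLeft, mul_assoc] }
  have hR : ∀ g (k : G → ℂ) h, R g k h = k (h * g) := fun _ _ _ => rfl
  let E : Submodule ℂ (G → ℂ) :=
    { carrier := {k | ∀ h, ∑ s ∈ T, k (s * h) + ε * ∑ s ∈ S, k (s * h) = z * k h}
      zero_mem' := by simp
      add_mem' := fun {x y} hx hy h => by
        simp only [Pi.add_apply, Finset.sum_add_distrib]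
        linear_combination hx h + hy h
      smul_mem' := fun c x hx h => by
        simp only [Pi.smul_apply, smul_eq_mul, ← Finset.mul_sum]
        linear_combination c * hx h }
  have hE : ∀ k, k ∈ E ↔ ∀ h, ∑ s ∈ T, k (s * h) + ε * ∑ s ∈ S, k (s * h) = z * k h :=
    fun _ => Iff.rfl
  obtain ⟨χ, hχ, n, hn, h⟩ := exists_isIrrChar_of_invariant R
    (fun g => (if g ∈ T then 1 else 0) + ε * if g ∈ S then 1 else 0) z E
    (fun h => hf0 ((Submodule.eq_bot_iff E).1 h f hf))
    (fun g v hv h => by simpa [hR, mul_assoc] using hv (h * g))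
    (fun v hv => funext fun h => by
      have := hv h
      rw [hT.sum_mul_comm, hS.sum_mul_comm] at this
      simpa [hR, add_mul, Finset.sum_add_distrib, mul_assoc, ← Finset.mul_sum] using this)
  exact ⟨χ, hχ, n, hn, by
    simpa [add_mul, Finset.sum_add_distrib, mul_assoc, ← Finset.mul_sum] using h⟩

/-- For an irreducible character `χ` of degree `n`, both `(χ(T) ± χ(S)) / n` are roots of the
characteristic polynomial of `SC(G, T, T, S, S)`. -/
theorem IsIrrChar.exists_aeval_charpoly_eq_zero {G : Type*} [Group G] [Fintype G] [DecidableEq G]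
    {T S : Finset G} (hT : ConjClosedF T) (hS : ConjClosedF S) {χ : G → ℂ} (hχ : IsIrrChar G χ) :
    ∃ (n : ℕ) (c d : ℂ), ∑ s ∈ T, χ s = n * c ∧ ∑ s ∈ S, χ s = n * d ∧
      Polynomial.aeval (c + d) (scMatrix T T S S).charpoly = 0 ∧
      Polynomial.aeval (c - d) (scMatrix T T S S).charpoly = 0 := by
  obtain ⟨V, _, _, _, _, ρ, hirr, hρ⟩ := hχ
  obtain ⟨c, hc⟩ := hT.exists_sum_eq_smul ρ hirr
  obtain ⟨d, hd⟩ := hS.exists_sum_eq_smul ρ hirr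
  obtain ⟨v, hv⟩ := exists_ne (0 : V)
  obtain ⟨φ, hφ⟩ := Module.Projective.exists_dual_ne_zero ℂ hv
  have htrace : ∀ {X : Finset G} {x : ℂ}, ∑ s ∈ X, ρ s = x • LinearMap.id →
      ∑ s ∈ X, χ s = Module.finrank ℂ V * x := fun {X x} hx => by
    simpa [hρ, mul_comm] using congrArg (LinearMap.trace ℂ V) hx
  let f : G → ℂ := fun g => φ (ρ g v)
  have hf0 : f ≠ 0 := fun h => hφ (by simpa [f] using congrFun h 1)
  have hf : ∀ {X : Finset G} {x : ℂ}, ∑ s ∈ X, ρ s = x • LinearMap.id →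
      ∀ h, ∑ s ∈ X, f (s * h) = x * f h := fun {X x} hx h => by
    simpa [f] using congrArg (fun A : Module.End ℂ V => φ (A (ρ h v))) hx
  refine ⟨_, c, d, htrace hc, htrace hd, ?_, ?_⟩
  · refine (aeval_charpoly_scMatrix_eq_zero_iff_s16 T S _).2 ⟨f, f, Or.inl hf0, ?_, ?_⟩ <;>
    · intro h
      rw [hf hc, hf hd]
      ring
  · refine (aeval_charpoly_scMatrix_eq_zero_iff_s16 T S _).2 ⟨f, -f, Or.inl hf0, ?_, ?_⟩ <;>
    · intro h
      simp only [Pi.neg_apply, Finset.sum_neg_distrib]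
      rw [hf hc, hf hd]
      ring

theorem stmt_16 {G : Type*} [Group G] [Fintype G] [DecidableEq G]
    (T11 T22 T12 T21 : Finset G)
    (h11 : ConjClosedF T11) (h22 : ConjClosedF T22)
    (h12 : ConjClosedF T12) (h21 : ConjClosedF T21)
    (heq : T11 = T22) (heq' : T12 = T21)
    (hinv : T12.image (fun x => x⁻¹) = T12) :
    IntermediateField.adjoin ℚ
        {z : ℂ | Polynomial.aeval z (scMatrix T11 T22 T12 T21).charpoly = 0}
      = IntermediateField.adjoin ℚ
        ({z : ℂ | ∃ χ : G → ℂ, IsIrrChar G χ ∧ z = ∑ s ∈ T11, χ s}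
          ∪ {z : ℂ | ∃ χ : G → ℂ, IsIrrChar G χ ∧ z = ∑ s ∈ T12, χ s}) := by
  subst heq heq'
  apply le_antisymm <;> rw [IntermediateField.adjoin_le_iff]
  · intro z hz
    obtain ⟨u, v, h0, hu, hv⟩ := (aeval_charpoly_scMatrix_eq_zero_iff_s16 T11 T12 z).1 hz
    have hmem : ∀ ε : ℤ, (∃ f : G → ℂ, f ≠ 0 ∧
        ∀ h, ∑ s ∈ T11, f (s * h) + ε * ∑ s ∈ T12, f (s * h) = z * f h) →
        z ∈ IntermediateField.adjoin ℚ
          ({z : ℂ | ∃ χ : G → ℂ, IsIrrChar G χ ∧ z = ∑ s ∈ T11, χ s}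
            ∪ {z : ℂ | ∃ χ : G → ℂ, IsIrrChar G χ ∧ z = ∑ s ∈ T12, χ s}) := by
      rintro ε ⟨f, hf0, hf⟩
      obtain ⟨χ, hχ, n, hn, h⟩ := h11.exists_isIrrChar_of_eigenvector h12 ε z f hf0 hf
      rw [eq_div_of_mul_eq (Nat.cast_ne_zero.2 hn) h.symm]
      exact div_mem (add_mem (subset_adjoin _ _ (Or.inl ⟨χ, hχ, rfl⟩))
        (mul_mem (_root_.intCast_mem _ _) (subset_adjoin _ _ (Or.inr ⟨χ, hχ, rfl⟩)))) (_root_.natCast_mem _ _)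
    by_cases hadd : u + v = 0
    · refine hmem (-1) ⟨u - v, fun hsub => ?_, fun h => ?_⟩
      · have hu0 : u = 0 := funext fun g => by
          have h1 := congrFun hadd g
          have h2 := congrFun hsub g
          simp only [Pi.add_apply, Pi.sub_apply, Pi.zero_apply] at h1 h2 ⊢
          linear_combination (h1 + h2) / 2
        simp_all
      · simp only [Pi.sub_apply, Finset.sum_sub_distrib]
        push_cast
        linear_combination hu h - hv h
    · refine hmem 1 ⟨u + v, hadd, fun h => ?_⟩
      simp only [Pi.add_apply, Finset.sum_add_distrib]
      push_cast
      linear_combination hu h + hv h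
  · rintro z (⟨χ, hχ, rfl⟩ | ⟨χ, hχ, rfl⟩) <;>
      obtain ⟨n, c, d, hc, hd, hadd, hsub⟩ := hχ.exists_aeval_charpoly_eq_zero h11 h12
    · rw [hc, show c = ((c + d) + (c - d)) / (2 : ℕ) by push_cast; ring]
      exact mul_mem (_root_.natCast_mem _ _) (div_mem (add_mem (subset_adjoin _ _ hadd)
        (subset_adjoin _ _ hsub)) (_root_.natCast_mem _ _))
    · rw [hd, show d = ((c + d) - (c - d)) / (2 : ℕ) by push_cast; ring]
      exact mul_mem (_root_.natCast_mem _ _) (div_mem (sub_mem (subset_adjoin _ _ hadd)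
        (subset_adjoin _ _ hsub)) (_root_.natCast_mem _ _))
end
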